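/- arXiv:2604.02555 — 11 statements merged into one kernel-verified Lean document; each statement's English description precedes it below -/
import Mathlib

section
/- Define g : ℝ → ℝ by g(t) = (38t − 35t³ + 21t⁵ − 5t⁷)/19. Then: (i) for every t ∈ [−1,1], −1 ≤ g(t) ≤ 1; (ii) for every t ∈ [−1,1], (1+t)·g(t) ≥ 2t and (1−t)·g(t) ≤ 2t; (iii) for all s, t ∈ [−1,1], |g(s) − g(t)| ≤ 2·|s − t| (that is, g is 2-Lipschitz on [−1,1]). -/
/-- The explicit polynomial `g = (16/19)·M₇ + (3/19)·id` used in the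
optimal malicious-noise learner. -/
noncomputable def gMal (t : ℝ) : ℝ := (38*t - 35*t^3 + 21*t^5 - 5*t^7) / 19

theorem gMal_hasDerivAt (t : ℝ) : HasDerivAt gMal ((3 + 35*(1-t^2)^3)/19) t := by
  have h := (((((hasDerivAt_id t).const_mul 38).sub ((hasDerivAt_pow 3 t).const_mul 35)).add
    ((hasDerivAt_pow 5 t).const_mul 21)).sub ((hasDerivAt_pow 7 t).const_mul 5)).div_const 19
  refine (h.congr_deriv ?_).congr_of_eventuallyEq (Filter.Eventually.of_forall fun x => ?_)
  · norm_num
    ring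
  · simp [gMal]

theorem gMal_mono : MonotoneOn gMal (Set.Icc (-1:ℝ) 1) := by
  refine monotoneOn_of_deriv_nonneg (convex_Icc _ _)
    (fun x _ => (gMal_hasDerivAt x).continuousAt.continuousWithinAt)
    (fun x _ => (gMal_hasDerivAt x).differentiableAt.differentiableWithinAt) ?_
  intro x hx
  rw [interior_Icc] at hx
  rw [(gMal_hasDerivAt x).deriv]
  have : 0 ≤ 1 - x^2 := by nlinarith [hx.1, hx.2]
  positivity

theorem gMal_mono2 : Monotone (fun t => 2 * t - gMal t) := by
  have hd : ∀ t, HasDerivAt (fun t => 2 * t - gMal t) (2 * 1 - (3 + 35*(1-t^2)^3)/19) t :=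
    fun t => ((hasDerivAt_id t).const_mul 2).sub (gMal_hasDerivAt t)
  refine monotone_of_deriv_nonneg (fun x => (hd x).differentiableAt) ?_
  intro x
  rw [(hd x).deriv]
  have : 2 * 1 - (3 + 35*(1-x^2)^3)/19 = 35/19 * (x^2 * ((x^2 - 3/2)^2 + 3/4)) := by ring
  rw [this]
  positivity

theorem gMal_lower (t : ℝ) (h1 : -1 ≤ t) (h2 : t ≤ 1) : 2*t ≤ (1+t) * gMal t := by
  have key : 0 ≤ 38 - t*(1+t)*(35-21*t^2+5*t^4) := by
    rcases le_total t 0 with h | h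
    · have a : 0 ≤ (-t)*(1+t) := mul_nonneg (by linarith) (by linarith)
      have b : 0 ≤ 35-21*t^2+5*t^4 := by nlinarith [sq_nonneg (t^2-2)]
      nlinarith [mul_nonneg a b]
    · have b : 0 ≤ t^2*(10*t^2-11*t+4) :=
        mul_nonneg (sq_nonneg t) (by nlinarith [sq_nonneg (t-11/20)])
      have c : 0 ≤ 38 - 36*t^2 := by nlinarith
      have d : 0 ≤ t^5 := by positivity
      have e : 0 ≤ (1-t)*((38 - 36*t^2) + t^2*(10*t^2-11*t+4) + 3*t + 5*t^5) :=
        mul_nonneg (by linarith) (by linarith)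
      linarith
  have := mul_nonneg (sq_nonneg t) key
  unfold gMal
  linarith

theorem gMal_neg (t : ℝ) : gMal (-t) = - gMal t := by
  unfold gMal
  ring

/-- (i) `g` maps `[-1,1]` into `[-1,1]`; (ii) `g` satisfies the malicious
constraints `(1+t)·g(t) ≥ 2t` and `(1−t)·g(t) ≤ 2t` on `[-1,1]`;
(iii) `g` is 2-Lipschitz on `[-1,1]`. -/
theorem stmt0 :
    (∀ t ∈ Set.Icc (-1:ℝ) 1, -1 ≤ gMal t ∧ gMal t ≤ 1) ∧
    (∀ t ∈ Set.Icc (-1:ℝ) 1, 2*t ≤ (1+t) * gMal t ∧ (1-t) * gMal t ≤ 2*t) ∧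
    (∀ s ∈ Set.Icc (-1:ℝ) 1, ∀ t ∈ Set.Icc (-1:ℝ) 1,
      |gMal s - gMal t| ≤ 2 * |s - t|) := by
  refine ⟨fun t ht => ?_, fun t ht => ⟨gMal_lower t ht.1 ht.2, ?_⟩, ?_⟩
  · have a := gMal_mono (Set.left_mem_Icc.2 (by norm_num)) ht ht.1
    have b := gMal_mono ht (Set.right_mem_Icc.2 (by norm_num)) ht.2
    have c : gMal 1 = 1 := by norm_num [gMal]
    rw [gMal_neg, c] at a
    rw [c] at b
    exact ⟨a, b⟩
  · have := gMal_lower (-t) (by linarith [ht.2]) (by linarith [ht.1])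
    rw [gMal_neg] at this
    linarith
  · have main : ∀ s ∈ Set.Icc (-1:ℝ) 1, ∀ t ∈ Set.Icc (-1:ℝ) 1, s ≤ t →
        |gMal s - gMal t| ≤ 2 * |s - t| := by
      intro s hs t ht hst
      have a := gMal_mono hs ht hst
      have b : 2 * s - gMal s ≤ 2 * t - gMal t := gMal_mono2 hst
      rw [abs_of_nonpos (by linarith), abs_of_nonpos (by linarith)]
      linarith
    intro s hs t ht
    rcases le_total s t with h | h
    · exact main s hs t ht h
    · rw [abs_sub_comm, abs_sub_comm s t]
      exact main t ht s hs h
end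

section
/- Let g : [−1,1] → [−1,1] satisfy the malicious constraints, let μ be a finitely supported probability distribution over functions X → {−1,1} with mean μ̄, and set h̄ := g∘μ̄. Then for every dataset S of size n ≥ 1 over X, E_{c∼μ}[ℓ_S(c, h̄)] ≤ 0. -/
/-- Let `g : [−1,1] → [−1,1]` satisfy the malicious constraints, let `μ` be a finitely
supported probability distribution over `±1`-valued functions on `X` with mean `μ̄`, and
let `h̄ := g ∘ μ̄`.  Then for every dataset `S` of size `n ≥ 1`, the expected malicious
loss `E_{c∼μ}[ℓ_S(c, h̄)]` is nonpositive. -/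
theorem stmt2 {X : Type*} (g : ℝ → ℝ)
    (hg_range : ∀ t ∈ Set.Icc (-1:ℝ) 1, g t ∈ Set.Icc (-1:ℝ) 1)
    (hg_lo : ∀ t ∈ Set.Icc (-1:ℝ) 1, 2*t ≤ (1+t) * g t)
    (hg_hi : ∀ t ∈ Set.Icc (-1:ℝ) 1, (1-t) * g t ≤ 2*t)
    (m : ℕ) (w : Fin m → ℝ) (cs : Fin m → X → ℝ)
    (hw : ∀ j, 0 ≤ w j) (hw1 : ∑ j, w j = 1)
    (hcs : ∀ j a, cs j a = 1 ∨ cs j a = -1)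
    (n : ℕ) (hn : 1 ≤ n) (x : Fin n → X) (y : Fin n → ℝ)
    (hy : ∀ i, y i = 1 ∨ y i = -1) :
    ∑ j, w j * ((1/(n:ℝ)) * ∑ i,
        (cs j (x i) * y i * (2 - g (∑ j', w j' * cs j' (x i)) * y i)
          - g (∑ j', w j' * cs j' (x i)) * y i)) ≤ 0 := by
  have key : ∀ i, ∑ j, w j * (cs j (x i) * y i * (2 - g (∑ j', w j' * cs j' (x i)) * y i)
          - g (∑ j', w j' * cs j' (x i)) * y i) ≤ 0 := by
    intro i
    have ht : (∑ j', w j' * cs j' (x i)) ∈ Set.Icc (-1:ℝ) 1 := by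
      constructor
      · rw [← hw1, ← Finset.sum_neg_distrib]
        refine Finset.sum_le_sum fun j _ => ?_
        rcases hcs j (x i) with h | h <;> rw [h] <;> linarith [hw j]
      · rw [← hw1]
        refine Finset.sum_le_sum fun j _ => ?_
        rcases hcs j (x i) with h | h <;> rw [h] <;> linarith [hw j]
    have lo := hg_lo _ ht
    have hi := hg_hi _ ht
    have e : ∀ G Y : ℝ, ∑ j, w j * (cs j (x i) * Y * (2 - G * Y) - G * Y)
        = (∑ j, w j * cs j (x i)) * (Y * (2 - G * Y)) - G * Y := by
      intro G Y
      have h2 : G * Y = ∑ j, w j * (G * Y) := by rw [← Finset.sum_mul, hw1, one_mul]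
      conv_rhs => rw [Finset.sum_mul]
      conv_rhs => arg 2; rw [h2]
      rw [← Finset.sum_sub_distrib]
      exact Finset.sum_congr rfl fun j _ => by ring
    rw [e]
    rcases hy i with h | h <;> rw [h] <;> linarith
  have e2 : ∀ F : Fin m → Fin n → ℝ, ∑ j, w j * ((1/(n:ℝ)) * ∑ i, F j i)
      = (1/(n:ℝ)) * ∑ i, ∑ j, w j * F j i := by
    intro F
    rw [Finset.sum_comm, Finset.mul_sum]
    refine Finset.sum_congr rfl fun j _ => ?_
    rw [← Finset.mul_sum]
    ring
  rw [e2]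
  exact mul_nonpos_of_nonneg_of_nonpos (by positivity) (Finset.sum_nonpos fun i _ => key i)
end

section
/- Let S = ((x_1,y_1),…,(x_n,y_n)) be a dataset of size n over X, h̄ : X → [−1,1], c : X → {−1,1}, ε ∈ ℝ, and let I ⊆ {1,…,n} be nonempty with c(x_i) = y_i for every i ∈ I. Set η := 1 − |I|/n. If ℓ_S(c,h̄) ≤ ε, then (1/|I|)·Σ_{i∈I} (1 − h̄(x_i)·y_i)/2 ≤ (η + ε/2)/(2(1−η)). -/
/-- If `I ⊆ {1,…,n}` is nonempty, `c` is consistent with the labels on `I`,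
`η := 1 − |I|/n`, and the malicious loss satisfies `ℓ_S(c,h̄) ≤ ε`, then the
average disagreement probability of `Rad(h̄)` on `S_I` is at most
`(η + ε/2)/(2(1−η))`. -/
theorem stmt3 {X : Type*} (n : ℕ) (x : Fin n → X) (y : Fin n → ℝ)
    (hy : ∀ i, y i = 1 ∨ y i = -1)
    (hbar : X → ℝ) (hhbar : ∀ a, hbar a ∈ Set.Icc (-1:ℝ) 1)
    (c : X → ℝ) (hc : ∀ a, c a = 1 ∨ c a = -1)
    (ε : ℝ) (I : Finset (Fin n)) (hI : I.Nonempty)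
    (hcons : ∀ i ∈ I, c (x i) = y i)
    (hloss : (1/(n:ℝ)) * ∑ i,
        (c (x i) * y i * (2 - hbar (x i) * y i) - hbar (x i) * y i) ≤ ε) :
    (1/(I.card:ℝ)) * ∑ i ∈ I, (1 - hbar (x i) * y i)/2
      ≤ ((1 - (I.card:ℝ)/(n:ℝ)) + ε/2) / (2 * (1 - (1 - (I.card:ℝ)/(n:ℝ)))) := by
  have hk : (0:ℝ) < I.card := by exact_mod_cast hI.card_pos
  have hn : (0:ℝ) < n := by
    obtain ⟨i, _⟩ := hI
    exact_mod_cast i.pos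
  set T : Fin n → ℝ := fun i =>
    c (x i) * y i * (2 - hbar (x i) * y i) - hbar (x i) * y i with hT
  have h1 : ∑ i ∈ I, T i = 4 * ∑ i ∈ I, (1 - hbar (x i) * y i)/2 := by
    rw [Finset.mul_sum]
    refine Finset.sum_congr rfl fun i hi => ?_
    simp only [hT, hcons i hi]
    rcases hy i with h | h <;> rw [h] <;> ring
  have h2 : ∑ i ∈ Iᶜ, (-2:ℝ) ≤ ∑ i ∈ Iᶜ, T i := by
    refine Finset.sum_le_sum fun i _ => ?_
    obtain ⟨ha, hb⟩ := hhbar (x i)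
    simp only [hT]
    rcases hy i with h | h <;> rcases hc (x i) with h' | h' <;> rw [h, h'] <;> linarith
  have h3 := Finset.sum_add_sum_compl I T
  have h4 : ((Iᶜ.card : ℕ) : ℝ) = n - I.card := by
    have := Finset.card_add_card_compl I
    rw [Fintype.card_fin] at this
    rw [eq_sub_iff_add_eq, add_comm]
    exact_mod_cast this
  rw [Finset.sum_const, nsmul_eq_mul, h4] at h2
  have h5 : ∑ i, T i ≤ ε * n := by
    rw [one_div, inv_mul_le_iff₀ hn] at hloss
    linarith
  have h6 : ((1 - (I.card:ℝ)/(n:ℝ)) + ε/2) / (2 * (1 - (1 - (I.card:ℝ)/(n:ℝ))))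
      = (1/(I.card:ℝ)) * ((n - I.card)/2 + n * ε/4) := by
    rw [sub_sub_cancel]
    field_simp
    ring
  rw [h6]
  refine mul_le_mul_of_nonneg_left ?_ (by positivity)
  linarith
end

section
/- There is an absolute constant C > 0 such that for all α ∈ [0,1), ε ∈ (0,1], every integer k ≥ C/(α+ε)², every finitely supported probability distribution μ over functions X → {−1,1} with mean μ̄, and every dataset S of size n ≥ 1 over X: E_{c∼μ}[ℓ_S^α(c, M_k∘μ̄)] ≤ ε. -/
/-- `sign(x) = 1` if `x ≥ 0` and `−1` otherwise. -/
noncomputable def rsign (x : ℝ) : ℝ := if 0 ≤ x then 1 else -1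

/-- The `k`-wise majority function
`M_k(t) = Σ_{j=0}^k sign(2j−k)·C(k,j)·((1+t)/2)^j·((1−t)/2)^{k−j}`. -/
noncomputable def Mk (k : ℕ) (t : ℝ) : ℝ :=
  ∑ j ∈ Finset.range (k+1),
    rsign (2*(j:ℝ) - (k:ℝ)) * (Nat.choose k j : ℝ) * ((1+t)/2)^j * ((1-t)/2)^(k-j)

/-- binomial weight -/
noncomputable def bw (k j : ℕ) (t : ℝ) : ℝ :=
  (Nat.choose k j : ℝ) * ((1+t)/2)^j * ((1-t)/2)^(k-j)

lemma bw_eq (k j : ℕ) (t : ℝ) : bw k j t = (bernsteinPolynomial ℝ k j).eval ((1+t)/2) := by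
  simp only [bw, bernsteinPolynomial, Polynomial.eval_mul, Polynomial.eval_pow,
    Polynomial.eval_natCast, Polynomial.eval_X, Polynomial.eval_sub, Polynomial.eval_one]
  congr 2
  ring

lemma bw_sum (k : ℕ) (t : ℝ) : ∑ j ∈ Finset.range (k+1), bw k j t = 1 := by
  simp only [bw_eq]
  rw [← Polynomial.eval_finsetSum, bernsteinPolynomial.sum]
  simp

lemma bw_var (k : ℕ) (t : ℝ) :
    ∑ j ∈ Finset.range (k+1), (2*(j:ℝ) - k - k*t)^2 * bw k j t = k * (1 - t^2) := by
  have h := congrArg (Polynomial.eval ((1+t)/2)) (bernsteinPolynomial.variance ℝ k)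
  rw [Polynomial.eval_finsetSum] at h
  simp only [Polynomial.eval_mul, Polynomial.eval_pow, Polynomial.eval_natCast, nsmul_eq_mul,
    Polynomial.eval_X, Polynomial.eval_sub, Polynomial.eval_one, ← bw_eq] at h
  have h2 : ∑ j ∈ Finset.range (k+1), (2*(j:ℝ) - k - k*t)^2 * bw k j t
      = 4 * ∑ j ∈ Finset.range (k+1), (k * ((1+t)/2) - (j:ℝ))^2 * bw k j t := by
    rw [Finset.mul_sum]
    refine Finset.sum_congr rfl fun j _ => ?_
    ring
  rw [h2, h]
  ring

lemma bw_nonneg (k j : ℕ) (t : ℝ) (h1 : -1 ≤ t) (h2 : t ≤ 1) : 0 ≤ bw k j t := by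
  have : 0 ≤ (1+t)/2 := by linarith
  have : 0 ≤ (1-t)/2 := by linarith
  unfold bw
  positivity

lemma Mk_eq (k : ℕ) (t : ℝ) :
    Mk k t = ∑ j ∈ Finset.range (k+1), rsign (2*(j:ℝ) - k) * bw k j t := by
  unfold Mk bw
  refine Finset.sum_congr rfl fun j _ => ?_
  ring

lemma Mk_triv (k : ℕ) (t : ℝ) (h1 : -1 ≤ t) (h2 : t ≤ 1) : |t| - t * Mk k t ≤ 2 * |t| := by
  have h : ∑ j ∈ Finset.range (k+1), (|t| - t * rsign (2*(j:ℝ) - k)) * bw k j t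
      ≤ ∑ j ∈ Finset.range (k+1), (2 * |t|) * bw k j t := by
    refine Finset.sum_le_sum fun j _ => mul_le_mul_of_nonneg_right ?_ (bw_nonneg k j t h1 h2)
    have := le_abs_self t
    have := neg_abs_le t
    unfold rsign
    split_ifs <;> linarith
  rw [← Finset.mul_sum, bw_sum] at h
  simp only [sub_mul, Finset.sum_sub_distrib] at h
  rw [← Finset.mul_sum, bw_sum] at h
  simp only [mul_assoc] at h
  rw [← Finset.mul_sum, ← Mk_eq] at h
  linarith

lemma Mk_cheb (k : ℕ) (hk : 0 < k) (t : ℝ) (h1 : -1 ≤ t) (h2 : t ≤ 1) :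
    (|t| - t * Mk k t) * (k * |t|) ≤ 2 * (1 - t^2) := by
  have hk' : (0:ℝ) < k := by exact_mod_cast hk
  have h : ∑ j ∈ Finset.range (k+1), ((|t| - t * rsign (2*(j:ℝ) - k)) * (k^2 * |t|)) * bw k j t
      ≤ ∑ j ∈ Finset.range (k+1), (2 * (2*(j:ℝ) - k - k*t)^2) * bw k j t := by
    refine Finset.sum_le_sum fun j _ => mul_le_mul_of_nonneg_right ?_ (bw_nonneg k j t h1 h2)
    generalize 2*(j:ℝ) - k = s
    unfold rsign
    rcases le_or_gt 0 t with ht | ht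
    · rw [abs_of_nonneg ht]
      split_ifs with hs
      · nlinarith [sq_nonneg (s - k*t)]
      · have : 0 ≤ (-s) * (k*t) := mul_nonneg (by linarith) (by positivity)
        nlinarith [sq_nonneg s]
    · rw [abs_of_neg ht]
      split_ifs with hs
      · have : 0 ≤ s * (k*(-t)) := mul_nonneg hs (mul_nonneg hk'.le (by linarith))
        nlinarith [sq_nonneg s]
      · nlinarith [sq_nonneg (s - k*t)]
  have e1 : ∑ j ∈ Finset.range (k+1), ((|t| - t * rsign (2*(j:ℝ) - k)) * (k^2 * |t|)) * bw k j t
      = (|t| - t * Mk k t) * (k^2 * |t|) := by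
    have : |t| = |t| * ∑ j ∈ Finset.range (k+1), bw k j t := by rw [bw_sum, mul_one]
    rw [Mk_eq]
    nth_rewrite 3 [this]
    rw [Finset.mul_sum, Finset.mul_sum, ← Finset.sum_sub_distrib, Finset.sum_mul]
    refine Finset.sum_congr rfl fun j _ => ?_
    ring
  have e2 : ∑ j ∈ Finset.range (k+1), (2 * (2*(j:ℝ) - k - k*t)^2) * bw k j t
      = 2 * (k * (1 - t^2)) := by
    rw [← bw_var, Finset.mul_sum]
    refine Finset.sum_congr rfl fun j _ => ?_
    ring
  rw [e1, e2] at h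
  refine le_of_mul_le_mul_left ?_ hk'
  linarith

lemma pointwise (α ε : ℝ) (ha : 0 ≤ α) (ha1 : α < 1) (he : 0 < ε) (he1 : ε ≤ 1) (k : ℕ)
    (hk : 16 / (α + ε)^2 ≤ (k : ℝ)) (t y : ℝ) (h1 : -1 ≤ t) (h2 : t ≤ 1)
    (hy : y = 1 ∨ y = -1) : t * ((1+α) * y - Mk k t) ≤ α + ε := by
  have hd : 0 < α + ε := by linarith
  have hk0 : (0:ℝ) < k := lt_of_lt_of_le (by positivity) hk
  have hkn : 0 < k := by exact_mod_cast hk0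
  rw [div_le_iff₀ (by positivity)] at hk
  have hyt : t * y ≤ |t| := by
    have := le_abs_self t
    have := neg_abs_le t
    rcases hy with rfl | rfl <;> linarith
  have hu0 := abs_nonneg t
  have hu1 : |t| ≤ 1 := abs_le.2 ⟨h1, h2⟩
  have A := Mk_triv k t h1 h2
  have B := Mk_cheb k hkn t h1 h2
  rw [← sq_abs] at B
  suffices H : (1 + α) * |t| - t * Mk k t ≤ α + ε by nlinarith
  generalize t * Mk k t = M at *
  generalize |t| = u at *
  generalize (k:ℝ) = K at *
  obtain ⟨d, hdd⟩ : ∃ d, d = α + ε := ⟨_, rfl⟩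
  rw [← hdd] at hd hk ⊢
  rcases le_or_gt u (1/2) with hu | hu
  · suffices u - M ≤ d / 2 by nlinarith
    by_contra! hc
    have h4 : d / 4 < u := by linarith
    have h5 : (d/2) * (K * (d/4)) < (u - M) * (K * u) := by gcongr
    nlinarith [sq_nonneg u]
  · suffices u - M ≤ (1 - u) * d by nlinarith
    by_contra! hc
    have h5 : ((1-u)*d) * (K * u) < (u - M) * (K * u) := by gcongr
    have h6 : (1-u) * (d * K * u) < (1-u) * (2 * (1+u)) := by nlinarith
    have h7 : d * K * u < 2 * (1+u) := lt_of_mul_lt_mul_left h6 (by linarith)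
    have h8 : 8 ≤ d * K := by
      have : d * (d * K) ≤ 2 * (d * K) := by gcongr; linarith
      nlinarith
    nlinarith

/-- There is an absolute constant `C > 0` such that for all `α ∈ [0,1)`, `ε ∈ (0,1]`,
every integer `k ≥ C/(α+ε)²`, every finitely supported probability distribution `μ`
over `±1`-valued functions with mean `μ̄`, and every dataset `S` of size `n ≥ 1`:
`E_{c∼μ}[ℓ_S^α(c, M_k∘μ̄)] ≤ ε`. -/
theorem stmt5 : ∃ C : ℝ, 0 < C ∧
    ∀ (α ε : ℝ), 0 ≤ α → α < 1 → 0 < ε → ε ≤ 1 →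
    ∀ k : ℕ, C / (α + ε)^2 ≤ (k : ℝ) →
    ∀ (X : Type) (m : ℕ) (w : Fin m → ℝ) (cs : Fin m → X → ℝ),
      (∀ j, 0 ≤ w j) → (∑ j, w j) = 1 → (∀ j a, cs j a = 1 ∨ cs j a = -1) →
    ∀ (n : ℕ), 1 ≤ n → ∀ (x : Fin n → X) (y : Fin n → ℝ), (∀ i, y i = 1 ∨ y i = -1) →
    ∑ j, w j * ((1/(n:ℝ)) * ∑ i,
        cs j (x i) * ((1+α) * y i - Mk k (∑ j', w j' * cs j' (x i))) - α) ≤ ε := by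
  refine ⟨16, by norm_num, ?_⟩
  intro α ε ha ha1 he he1 k hk X m w cs hw hw1 hcs n hn x y hy
  have hn' : (0:ℝ) < n := by exact_mod_cast hn
  have key : ∀ i, (∑ j', w j' * cs j' (x i)) *
      ((1+α) * y i - Mk k (∑ j', w j' * cs j' (x i))) ≤ α + ε := by
    intro i
    refine pointwise α ε ha ha1 he he1 k hk _ _ ?_ ?_ (hy i)
    · rw [← hw1, ← Finset.sum_neg_distrib]
      refine Finset.sum_le_sum fun j _ => ?_
      have := hw j
      rcases hcs j (x i) with h | h <;> rw [h] <;> linarith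
    · rw [← hw1]
      refine Finset.sum_le_sum fun j _ => ?_
      have := hw j
      rcases hcs j (x i) with h | h <;> rw [h] <;> linarith
  generalize hA : (fun i => (1+α) * y i - Mk k (∑ j', w j' * cs j' (x i))) = A at *
  have hA' : ∀ i, (1+α) * y i - Mk k (∑ j', w j' * cs j' (x i)) = A i := fun i => congrFun hA i
  simp only [hA'] at *
  have e : ∑ j, w j * ((1/(n:ℝ)) * ∑ i, cs j (x i) * A i - α)
      = (1/(n:ℝ)) * (∑ i, (∑ j', w j' * cs j' (x i)) * A i) - α := by
    simp only [mul_sub, Finset.sum_sub_distrib]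
    rw [← Finset.sum_mul, hw1, one_mul]
    congr 1
    simp only [Finset.mul_sum, Finset.sum_mul]
    rw [Finset.sum_comm]
    refine Finset.sum_congr rfl fun i _ => Finset.sum_congr rfl fun j _ => ?_
    ring
  rw [e]
  have hs := Finset.sum_le_sum (fun i (_ : i ∈ Finset.univ) => key i)
  simp only [Finset.sum_const, Finset.card_univ, Fintype.card_fin, nsmul_eq_mul] at hs
  have : (1/(n:ℝ)) * (∑ i, (∑ j', w j' * cs j' (x i)) * A i) ≤ α + ε := by
    rw [one_div, inv_mul_le_iff₀ hn']
    exact hs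
  linarith
end

section
/- Let X be a measurable space, let μ be a finitely supported probability distribution over measurable functions X → {−1,1} with mean μ̄, and let D be a probability measure on X. Then for every integer k ≥ 1, ∫ M_k(μ̄(x))·μ̄(x) dD(x) ≥ ∫ |μ̄(x)| dD(x) − 2/√k. Equivalently, if c, c₁, …, c_k are drawn i.i.d. from μ and x ∼ D independently, then E[sign(c₁(x)+⋯+c_k(x))·c(x)] ≥ E[sign(μ̄(x))·c(x)] − 2/√k, where sign(x) = 1 if x ≥ 0 and −1 otherwise. -/
open MeasureTheory

theorem aux_point (y t s : ℝ) (hs : 0 < s) :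
    |t| - s * (y - t)^2 - 1 / s ≤ rsign y * t := by
  have h1 : 2 * |y - t| ≤ s * (y - t)^2 + 1 / s := by
    have h2 : s * (y - t)^2 + 1 / s - 2 * |y - t| = (s * |y - t| - 1)^2 / s := by
      rw [← sq_abs (y - t)]
      field_simp
      ring
    have h3 : 0 ≤ (s * |y - t| - 1)^2 / s := by positivity
    linarith
  have h4 : |t| - 2 * |y - t| ≤ rsign y * t := by
    unfold rsign
    split_ifs with h <;> rcases abs_cases t with ha | ha <;>
      rcases abs_cases (y - t) with hd | hd <;> linarith
  linarith

theorem aux_sum (k : ℕ) (p : ℝ) :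
    ∑ j ∈ Finset.range (k+1), (Nat.choose k j : ℝ) * p^j * (1-p)^(k-j) = 1 := by
  have h := congrArg (Polynomial.eval p) (bernsteinPolynomial.sum ℝ k)
  simpa [Polynomial.eval_finsetSum, bernsteinPolynomial] using h

theorem aux_var (k : ℕ) (p : ℝ) :
    ∑ j ∈ Finset.range (k+1), (k * p - j)^2 * ((Nat.choose k j : ℝ) * p^j * (1-p)^(k-j))
      = k * p * (1 - p) := by
  have h := congrArg (Polynomial.eval p) (bernsteinPolynomial.variance ℝ k)
  simpa [Polynomial.eval_finsetSum, bernsteinPolynomial] using h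

theorem aux_rsign (y c : ℝ) (hc : 0 < c) : rsign (y / c) = rsign y := by
  unfold rsign
  simp only [le_div_iff₀ hc, zero_mul]

theorem aux_Mk (k : ℕ) (hk : 1 ≤ k) (t : ℝ) (h1 : -1 ≤ t) (h2 : t ≤ 1) :
    |t| - 2 / Real.sqrt k ≤ Mk k t * t := by
  have hk0 : (0:ℝ) < k := by exact_mod_cast hk
  set s := Real.sqrt k with hs
  have hs0 : 0 < s := Real.sqrt_pos.mpr hk0
  have hss : s * s = k := Real.mul_self_sqrt hk0.le
  obtain ⟨p, hp⟩ : ∃ p, p = (1 + t) / 2 := ⟨_, rfl⟩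
  have hq : (1 - t) / 2 = 1 - p := by rw [hp]; ring
  have ht : t = 2 * p - 1 := by rw [hp]; ring
  have hp0 : 0 ≤ p := by linarith
  have hp1 : 0 ≤ 1 - p := by linarith
  have key : ∑ j ∈ Finset.range (k+1),
      (|t| - 1 / s - 4 * s / k^2 * (k * p - j)^2) * ((Nat.choose k j : ℝ) * p^j * (1-p)^(k-j))
      ≤ Mk k t * t := by
    unfold Mk
    rw [Finset.sum_mul]
    refine Finset.sum_le_sum fun j _ => ?_
    rw [hq, ← hp]
    have h := aux_point ((2 * j - k) / k) t s hs0
    rw [aux_rsign _ _ hk0] at h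
    have e : s * ((2 * (j:ℝ) - k) / k - t)^2 = 4 * s / k^2 * (k * p - j)^2 := by
      rw [ht]; field_simp; ring
    rw [e] at h
    have hb : 0 ≤ (Nat.choose k j : ℝ) * p^j * (1-p)^(k-j) := by positivity
    have := mul_le_mul_of_nonneg_right h hb
    linarith
  have e2 : ∑ j ∈ Finset.range (k+1),
      (|t| - 1 / s - 4 * s / k^2 * (k * p - j)^2) * ((Nat.choose k j : ℝ) * p^j * (1-p)^(k-j))
      = (|t| - 1 / s) - 4 * s / k^2 * (k * p * (1 - p)) := by
    simp only [sub_mul _ (4 * s / (k:ℝ)^2 * _), Finset.sum_sub_distrib, ← Finset.mul_sum,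
      mul_assoc (4 * s / (k:ℝ)^2), aux_var]
    rw [aux_sum, mul_one]
  have e3 : 4 * s / (k:ℝ)^2 * (k * p * (1 - p)) = (4 * p * (1 - p)) / s := by
    rw [← hss]; field_simp
  have e4 : (4 * p * (1 - p)) / s ≤ 1 / s := by
    gcongr
    nlinarith [sq_nonneg (2 * p - 1)]
  have e5 : 2 / s = 1 / s + 1 / s := by ring
  linarith

theorem aux_cont (k : ℕ) : Continuous (Mk k) := by
  unfold Mk
  fun_prop

/-- For a finitely supported distribution `μ` over measurable `±1`-valued functions
with mean `μ̄` and a probability measure `D` on `X`, for every `k ≥ 1`: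
`∫ M_k(μ̄(x))·μ̄(x) dD(x) ≥ ∫ |μ̄(x)| dD(x) − 2/√k`. -/
theorem stmt7 {X : Type*} [MeasurableSpace X] (D : Measure X) [IsProbabilityMeasure D]
    (m : ℕ) (w : Fin m → ℝ) (cs : Fin m → X → ℝ)
    (hw : ∀ j, 0 ≤ w j) (hw1 : ∑ j, w j = 1)
    (hcs : ∀ j a, cs j a = 1 ∨ cs j a = -1)
    (hmeas : ∀ j, Measurable (cs j))
    (k : ℕ) (hk : 1 ≤ k) :
    (∫ a, |∑ j, w j * cs j a| ∂D) - 2 / Real.sqrt k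
      ≤ ∫ a, Mk k (∑ j, w j * cs j a) * (∑ j, w j * cs j a) ∂D := by
  have hb : ∀ a, ∑ j, w j * cs j a ∈ Set.Icc (-1:ℝ) 1 := by
    intro a
    have h : |∑ j, w j * cs j a| ≤ 1 := by
      refine (Finset.abs_sum_le_sum_abs _ _).trans (le_of_eq ?_)
      rw [← hw1]
      refine Finset.sum_congr rfl fun j _ => ?_
      rw [abs_mul, abs_of_nonneg (hw j)]
      rcases hcs j a with h | h <;> simp [h]
    exact abs_le.mp h
  have hm : Measurable fun a => ∑ j, w j * cs j a :=
    Finset.measurable_sum _ fun j _ => (hmeas j).const_mul _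
  have hInt : ∀ f : ℝ → ℝ, Continuous f → Integrable (fun a => f (∑ j, w j * cs j a)) D := by
    intro f hf
    obtain ⟨C, hC⟩ := (isCompact_Icc (a := (-1:ℝ)) (b := 1)).exists_bound_of_continuousOn
      hf.continuousOn
    exact Integrable.of_bound (hf.measurable.comp hm).aestronglyMeasurable C
      (Filter.Eventually.of_forall fun a => hC _ (hb a))
  have i1 := hInt (fun t => |t|) continuous_abs
  have i2 := hInt (fun t => Mk k t * t) ((aux_cont k).mul continuous_id)
  have e : (∫ a, |∑ j, w j * cs j a| ∂D) - 2 / Real.sqrt k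
      = ∫ a, (|∑ j, w j * cs j a| - 2 / Real.sqrt k) ∂D := by
    rw [integral_sub i1 (integrable_const _)]
    simp
  rw [e]
  exact integral_mono (i1.sub (integrable_const _)) i2
    fun a => aux_Mk k hk _ (hb a).1 (hb a).2
end

section
/- Let X be a measurable space, let μ be a finitely supported probability distribution over measurable functions X → {−1,1} with mean μ̄, let D be a probability measure on X, and let S be a dataset of size n ≥ 1 over X. For each c in the support of μ define f_{c,μ} : X → [−1,1] by f_{c,μ}(x) := (c(x)·μ̄(x) − 1)/(c(x)·μ̄(x) + 1) if c(x)·μ̄(x) ≥ 0, and f_{c,μ}(x) := −1 otherwise. Then Pr_{x∼D, c∼μ}[sign(μ̄(x)) ≠ c(x)] ≤ E_{c∼μ}[η(c, f_{c,μ}, S, D)], where the left-hand side equals ∫ (1 − |μ̄(x)|)/2 dD(x) and sign(x) = 1 if x ≥ 0 and −1 otherwise. -/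
open MeasureTheory

/-- The corruption estimate
`η(c,f,S,D) := (1/(4n))·Σ_i [1 + f(x_i) + c(x_i)·y_i·(f(x_i) − 1)] − (1/2)·∫ f dD`. -/
noncomputable def etaEst {X : Type*} [MeasurableSpace X] (D : Measure X)
    (n : ℕ) (x : Fin n → X) (y : Fin n → ℝ) (c : X → ℝ) (f : X → ℝ) : ℝ :=
  (1/(4*(n:ℝ))) * ∑ i, (1 + f (x i) + c (x i) * y i * (f (x i) - 1))
    - (1/2) * ∫ a, f a ∂D

/-- The detection function `f_{c,μ}(x)`, written as a function of `c(x)` and `μ̄(x)`: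
`(c·μ̄ − 1)/(c·μ̄ + 1)` if `c·μ̄ ≥ 0` and `−1` otherwise. -/
noncomputable def fdet (c m : ℝ) : ℝ := if 0 ≤ c * m then (c*m - 1)/(c*m + 1) else -1

lemma fdet_abs_le (c m : ℝ) : |fdet c m| ≤ 1 := by
  unfold fdet
  split_ifs with h
  · rw [abs_le]
    constructor
    · rw [le_div_iff₀ (by linarith)]; linarith
    · rw [div_le_iff₀ (by linarith)]; linarith
  · simp

lemma fdet_affine (c M : ℝ) (hc : c = 1 ∨ c = -1) :
    fdet c M = (fdet 1 M + fdet (-1) M) / 2 + (fdet 1 M - fdet (-1) M) / 2 * c := by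
  rcases hc with rfl | rfl <;> ring

lemma fdet_AB (M : ℝ) :
    (fdet 1 M + fdet (-1) M) / 2 + (fdet 1 M - fdet (-1) M) / 2 * M = |M| - 1 ∧
    (fdet 1 M + fdet (-1) M) / 2 * M + (fdet 1 M - fdet (-1) M) / 2 = 0 := by
  unfold fdet
  rcases lt_trichotomy M 0 with h | h | h
  · have h1 : ¬ (0 ≤ 1 * M) := by linarith
    have h2 : 0 ≤ -1 * M := by linarith
    have h3 : 1 - M ≠ 0 := by linarith
    rw [if_neg h1, if_pos h2, abs_of_neg h, show -1 * M + 1 = 1 - M by ring]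
    constructor <;> field_simp <;> ring
  · subst h; norm_num
  · have h1 : ¬ (0 ≤ -1 * M) := by linarith
    have h2 : 0 ≤ 1 * M := by linarith
    have h3 : 1 * M + 1 ≠ 0 := by linarith
    rw [if_neg h1, if_pos h2, abs_of_pos h]
    constructor <;> field_simp <;> ring

lemma fdet_mean {m : ℕ} (w c : Fin m → ℝ) (hw1 : ∑ j, w j = 1)
    (hc : ∀ j, c j = 1 ∨ c j = -1) :
    ∑ j, w j * fdet (c j) (∑ j', w j' * c j') = |∑ j, w j * c j| - 1 ∧
    ∑ j, w j * (c j * fdet (c j) (∑ j', w j' * c j')) = 0 := by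
  generalize hM : ∑ j', w j' * c j' = M
  obtain ⟨hA, hB⟩ := fdet_AB M
  generalize hA' : (fdet 1 M + fdet (-1) M) / 2 = A at hA hB
  generalize hB' : (fdet 1 M - fdet (-1) M) / 2 = B at hA hB
  have hf : ∀ j, fdet (c j) M = A + B * c j := fun j => by
    rw [fdet_affine _ M (hc j), hA', hB']
  constructor
  · rw [← hA, ← hM, ← mul_one A, ← hw1, Finset.mul_sum, Finset.mul_sum,
      ← Finset.sum_add_distrib]
    rw [hM]
    refine Finset.sum_congr rfl fun j _ => ?_
    rw [hf]; ring
  · rw [← hB, ← mul_one B, ← hw1, ← hM, Finset.mul_sum, Finset.mul_sum,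
      ← Finset.sum_add_distrib]
    rw [hM]
    refine Finset.sum_congr rfl fun j _ => ?_
    rw [hf]
    rcases hc j with h | h <;> rw [h] <;> ring

/-- For any finitely supported probability distribution `μ` over measurable
`±1`-valued functions with mean `μ̄`, probability measure `D`, and dataset `S`
of size `n ≥ 1`:
`Pr_{x∼D, c∼μ}[sign(μ̄(x)) ≠ c(x)] = ∫ (1 − |μ̄(x)|)/2 dD(x) ≤ E_{c∼μ}[η(c, f_{c,μ}, S, D)]`. -/
theorem stmt8 {X : Type*} [MeasurableSpace X] (D : Measure X) [IsProbabilityMeasure D]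
    (m : ℕ) (w : Fin m → ℝ) (cs : Fin m → X → ℝ)
    (hw : ∀ j, 0 ≤ w j) (hw1 : ∑ j, w j = 1)
    (hcs : ∀ j a, cs j a = 1 ∨ cs j a = -1)
    (hmeas : ∀ j, Measurable (cs j))
    (n : ℕ) (hn : 1 ≤ n) (x : Fin n → X) (y : Fin n → ℝ)
    (hy : ∀ i, y i = 1 ∨ y i = -1) :
    (∫ a, (1 - |∑ j, w j * cs j a|)/2 ∂D)
      ≤ ∑ j, w j * etaEst D n x y (cs j)
          (fun a => fdet (cs j a) (∑ j', w j' * cs j' a)) := by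
  have hint : ∀ j, Integrable (fun a => fdet (cs j a) (∑ j', w j' * cs j' a)) D := by
    intro j
    refine Integrable.of_bound (C := 1) ?_ (Filter.Eventually.of_forall fun a => fdet_abs_le _ _)
    apply Measurable.aestronglyMeasurable
    have hM : Measurable (fun a => ∑ j', w j' * cs j' a) :=
      Finset.measurable_sum _ fun j' _ => (hmeas j').const_mul _
    have hp := (hmeas j).mul hM
    unfold fdet
    exact Measurable.ite (measurableSet_le measurable_const hp)
      ((hp.sub_const 1).div (hp.add_const 1)) measurable_const
  have hI : ∫ a, (1 - |∑ j, w j * cs j a|)/2 ∂D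
      = ∑ j, w j * (-(1/2) * ∫ a, fdet (cs j a) (∑ j', w j' * cs j' a) ∂D) := by
    have : ∀ a, (1 - |∑ j, w j * cs j a|)/2
        = ∑ j, (-(1/2) * w j) * fdet (cs j a) (∑ j', w j' * cs j' a) := by
      intro a
      have := (fdet_mean w (fun j => cs j a) hw1 (fun j => hcs j a)).1
      simp only [mul_assoc]
      rw [← Finset.mul_sum, this]; ring
    simp_rw [this]
    rw [integral_finsetSum _ fun j _ => (hint j).const_mul _]
    refine Finset.sum_congr rfl fun j _ => ?_
    rw [integral_const_mul]; ring
  have hS : 0 ≤ ∑ j, w j * ((1/(4*(n:ℝ))) * ∑ i, (1 + fdet (cs j (x i)) (∑ j', w j' * cs j' (x i))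
      + cs j (x i) * y i * (fdet (cs j (x i)) (∑ j', w j' * cs j' (x i)) - 1))) := by
    simp_rw [Finset.mul_sum]
    rw [Finset.sum_comm]
    refine Finset.sum_nonneg fun i _ => ?_
    obtain ⟨h1, h2⟩ := fdet_mean w (fun j => cs j (x i)) hw1 (fun j => hcs j (x i))
    simp only at h1 h2
    have key : ∑ j, w j * (1/(4*(n:ℝ)) * (1 + fdet (cs j (x i)) (∑ j', w j' * cs j' (x i))
        + cs j (x i) * y i * (fdet (cs j (x i)) (∑ j', w j' * cs j' (x i)) - 1)))
        = 1/(4*(n:ℝ)) * (∑ j, w j + ∑ j, w j * fdet (cs j (x i)) (∑ j', w j' * cs j' (x i))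
          + y i * ∑ j, w j * (cs j (x i) * fdet (cs j (x i)) (∑ j', w j' * cs j' (x i)))
          - y i * ∑ j, w j * cs j (x i)) := by
      generalize hM : ∑ j', w j' * cs j' (x i) = M
      rw [← hM, Finset.mul_sum, Finset.mul_sum, ← Finset.sum_add_distrib,
        ← Finset.sum_add_distrib, ← Finset.sum_sub_distrib, Finset.mul_sum]
      refine Finset.sum_congr rfl fun j _ => ?_
      ring
    rw [key, h1, h2, hw1]
    refine mul_nonneg (by positivity) ?_
    have ha := le_abs_self (∑ j, w j * cs j (x i))
    have hb := neg_abs_le (∑ j, w j * cs j (x i))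
    rcases hy i with h | h <;> rw [h] <;> linarith
  rw [hI]
  unfold etaEst
  have : ∀ a b : ℝ, 0 ≤ b → ∀ c, c = b + a → a ≤ c := fun a b hb c hc => by linarith
  refine this _ _ hS _ ?_
  rw [← Finset.sum_add_distrib]
  refine Finset.sum_congr rfl fun j _ => ?_
  ring
end

section
/- For μ̄ ∈ [−1,1] and c ∈ {−1,1}, define f(c, μ̄) := (c·μ̄ − 1)/(c·μ̄ + 1) if c·μ̄ ≥ 0 and f(c, μ̄) := −1 otherwise. Then for every μ̄ ∈ [−1,1]: ((1+μ̄)/2)·f(1,μ̄) + ((1−μ̄)/2)·f(−1,μ̄) = |μ̄| − 1, and ((1+μ̄)/2)·f(1,μ̄) − ((1−μ̄)/2)·f(−1,μ̄) = 0. That is, for c drawn from {−1,1} with P(c = 1) = (1+μ̄)/2, one has E[f(c,μ̄)] = |μ̄| − 1 and E[c·f(c,μ̄)] = 0. -/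
/-- For `c ∼ Rad(μ̄)` (i.e. `P(c = 1) = (1+μ̄)/2`), one has
`E[f(c,μ̄)] = |μ̄| − 1` and `E[c·f(c,μ̄)] = 0`. -/
theorem stmt9 : ∀ μ ∈ Set.Icc (-1:ℝ) 1,
    ((1+μ)/2) * fdet 1 μ + ((1-μ)/2) * fdet (-1) μ = |μ| - 1 ∧
    ((1+μ)/2) * fdet 1 μ - ((1-μ)/2) * fdet (-1) μ = 0 := by
  intro μ _
  rcases lt_trichotomy μ 0 with h | h | h
  · have h1 : fdet 1 μ = -1 := by
      unfold fdet; rw [if_neg (by linarith)]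
    have h2 : ((1-μ)/2) * fdet (-1) μ = (-μ-1)/2 := by
      unfold fdet; rw [if_pos (by linarith)]
      have h3 : -1 * μ + 1 ≠ 0 := ne_of_gt (by linarith)
      rw [mul_div_assoc', div_eq_iff h3]
      ring
    rw [h2, h1, abs_of_neg h]
    constructor <;> ring
  · subst h
    norm_num [fdet]
  · have h1 : fdet (-1) μ = -1 := by
      unfold fdet; rw [if_neg (by linarith)]
    have h2 : ((1+μ)/2) * fdet 1 μ = (μ-1)/2 := by
      unfold fdet; rw [if_pos (by linarith)]
      have h3 : 1 * μ + 1 ≠ 0 := ne_of_gt (by linarith)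
      rw [mul_div_assoc', div_eq_iff h3]
      ring
    rw [h2, h1, abs_of_pos h]
    constructor <;> ring
end

section
/- Let S = ((x_1,y_1),…,(x_n,y_n)) be a dataset of size n ≥ 1 over X, τ ≥ 0, μ : X → [−1,1], and C a collection of functions X → {−1,1}. Assume: (multiaccuracy) for every c ∈ C, (1/n)·Σ_{i=1}^n c(x_i)·(y_i − μ(x_i)) ≤ τ; and (calibration) for every value v ∈ {μ(x_1),…,μ(x_n)}, |(Σ_{i : μ(x_i)=v} y_i)/|{i : μ(x_i)=v}| − v| ≤ τ. Let g : [−1,1] → [−1,1] be a bijection satisfying the malicious constraints. Then for every c ∈ C, ℓ_S(c, g∘μ) ≤ 3τ. -/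
open scoped Classical

/-- If `μ` is `τ`-multiaccurate and `τ`-calibrated on the dataset `S` w.r.t. `C`,
and `g : [−1,1] → [−1,1]` is a bijection satisfying the malicious constraints,
then for every `c ∈ C` the malicious loss satisfies `ℓ_S(c, g∘μ) ≤ 3τ`. -/
theorem stmt12 {X : Type*} (n : ℕ) (hn : 1 ≤ n) (x : Fin n → X) (y : Fin n → ℝ)
    (hy : ∀ i, y i = 1 ∨ y i = -1) (τ : ℝ) (hτ : 0 ≤ τ)
    (μ : X → ℝ) (hμ : ∀ a, μ a ∈ Set.Icc (-1:ℝ) 1)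
    (C : Set (X → ℝ)) (hC : ∀ c ∈ C, ∀ a, c a = 1 ∨ c a = -1)
    (g : ℝ → ℝ) (hgbij : Set.BijOn g (Set.Icc (-1:ℝ) 1) (Set.Icc (-1:ℝ) 1))
    (hg_lo : ∀ t ∈ Set.Icc (-1:ℝ) 1, 2*t ≤ (1+t) * g t)
    (hg_hi : ∀ t ∈ Set.Icc (-1:ℝ) 1, (1-t) * g t ≤ 2*t)
    (hma : ∀ c ∈ C, (1/(n:ℝ)) * ∑ i, c (x i) * (y i - μ (x i)) ≤ τ)
    (hcal : ∀ i₀ : Fin n,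
      |(∑ i ∈ Finset.univ.filter (fun i => μ (x i) = μ (x i₀)), y i) /
          ((Finset.univ.filter (fun i => μ (x i) = μ (x i₀))).card : ℝ)
        - μ (x i₀)| ≤ τ) :
    ∀ c ∈ C, (1/(n:ℝ)) * ∑ i,
        (c (x i) * y i * (2 - g (μ (x i)) * y i) - g (μ (x i)) * y i) ≤ 3*τ := by
  intro c hc
  have hn0 : (0:ℝ) < n := by exact_mod_cast hn
  have h1 := hma c hc
  rw [one_div, inv_mul_le_iff₀ hn0] at h1 ⊢
  have h3 : ∑ i, g (μ (x i)) * (μ (x i) - y i) ≤ n * τ := by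
    have hmaps : ∀ i ∈ (Finset.univ : Finset (Fin n)),
        μ (x i) ∈ Finset.univ.image (fun i => μ (x i)) :=
      fun i hi => Finset.mem_image_of_mem (fun i => μ (x i)) hi
    have hcard := Finset.card_eq_sum_card_fiberwise hmaps
    have hcard' : (n:ℝ) = ∑ v ∈ Finset.univ.image (fun i => μ (x i)),
        ((Finset.univ.filter (fun i => μ (x i) = v)).card : ℝ) := by
      rw [Finset.card_univ, Fintype.card_fin] at hcard
      exact_mod_cast hcard
    rw [← Finset.sum_fiberwise_of_maps_to hmaps, hcard', Finset.sum_mul]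
    apply Finset.sum_le_sum
    intro v hv
    obtain ⟨i₀, -, rfl⟩ := Finset.mem_image.mp hv
    have hk := hcal i₀
    have hg := hgbij.mapsTo (hμ (x i₀))
    have hgabs : |g (μ (x i₀))| ≤ 1 := abs_le.mpr hg
    have hpos : (0:ℝ) < ((Finset.univ.filter (fun i => μ (x i) = μ (x i₀))).card : ℝ) := by
      have : 0 < (Finset.univ.filter (fun i => μ (x i) = μ (x i₀))).card :=
        Finset.card_pos.mpr ⟨i₀, by simp⟩
      exact_mod_cast this
    have e : ∑ i ∈ Finset.univ.filter (fun i => μ (x i) = μ (x i₀)),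
        g (μ (x i)) * (μ (x i) - y i) =
        ((Finset.univ.filter (fun i => μ (x i) = μ (x i₀))).card : ℝ) *
        (-(g (μ (x i₀)) * ((∑ i ∈ Finset.univ.filter (fun i => μ (x i) = μ (x i₀)), y i) /
          ((Finset.univ.filter (fun i => μ (x i) = μ (x i₀))).card : ℝ) - μ (x i₀)))) := by
      have e1 : ∑ i ∈ Finset.univ.filter (fun i => μ (x i) = μ (x i₀)),
          g (μ (x i)) * (μ (x i) - y i) =
          ∑ i ∈ Finset.univ.filter (fun i => μ (x i) = μ (x i₀)),
          g (μ (x i₀)) * (μ (x i₀) - y i) := by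
        apply Finset.sum_congr rfl
        intro i hi
        rw [(Finset.mem_filter.mp hi).2]
      rw [e1, ← Finset.mul_sum, Finset.sum_sub_distrib, Finset.sum_const, nsmul_eq_mul]
      field_simp
      ring
    rw [e]
    apply mul_le_mul_of_nonneg_left _ hpos.le
    refine (neg_le_abs _).trans ?_
    rw [abs_mul]
    exact (mul_le_mul hgabs hk (abs_nonneg _) zero_le_one).trans (by rw [one_mul])
  have h2 : ∑ i, (c (x i) * y i * (2 - g (μ (x i)) * y i) - g (μ (x i)) * y i) ≤
      ∑ i, (2 * (c (x i) * (y i - μ (x i))) + g (μ (x i)) * (μ (x i) - y i)) := by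
    apply Finset.sum_le_sum
    intro i _
    have hl := hg_lo _ (hμ (x i))
    have hh := hg_hi _ (hμ (x i))
    rcases hy i with h | h <;> rcases hC c hc (x i) with h' | h' <;> rw [h, h'] <;> linarith
  rw [Finset.sum_add_distrib, ← Finset.mul_sum] at h2
  linarith
end

section
/- Let S = ((x_1,y_1),…,(x_n,y_n)) be a dataset of size n ≥ 1 over X, f : {−1,1}³ → ℝ, L ≥ 0, and g : ℝ → ℝ satisfying |g(s) − g(t)| ≤ L·|s − t| for all s, t ∈ [−1,1]. For ν ∈ ℝⁿ let ∇P(ν) denote the vector whose i-th entry is −(1/(4n))·(a_{y_i}·g(ν_i) + b_{y_i}). Then for all ν, ν' ∈ [−1,1]ⁿ, ‖∇P(ν) − ∇P(ν')‖₂ ≤ (‖f‖_∞ · L / n)·‖ν − ν'‖₂, where ‖f‖_∞ := max_{(c,h,y)∈{−1,1}³} |f(c,h,y)| and ‖·‖₂ is the Euclidean norm on ℝⁿ. -/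
/-- `a_y := f(1,1,y) + f(−1,−1,y) − f(1,−1,y) − f(−1,1,y)`. -/
def acoef (f : ℝ → ℝ → ℝ → ℝ) (y : ℝ) : ℝ :=
  f 1 1 y + f (-1) (-1) y - f 1 (-1) y - f (-1) 1 y

/-- `b_y := f(1,1,y) + f(1,−1,y) − f(−1,1,y) − f(−1,−1,y)`. -/
def bcoef (f : ℝ → ℝ → ℝ → ℝ) (y : ℝ) : ℝ :=
  f 1 1 y + f 1 (-1) y - f (-1) 1 y - f (-1) (-1) y

/-- `‖f‖_∞ := max_{(c,h,y) ∈ {−1,1}³} |f(c,h,y)|`. -/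
noncomputable def Fnorm (f : ℝ → ℝ → ℝ → ℝ) : ℝ :=
  |f 1 1 1| ⊔ |f 1 (-1) 1| ⊔ |f (-1) 1 1| ⊔ |f (-1) (-1) 1| ⊔
  |f 1 1 (-1)| ⊔ |f 1 (-1) (-1)| ⊔ |f (-1) 1 (-1)| ⊔ |f (-1) (-1) (-1)|

theorem acoef_abs_le (f : ℝ → ℝ → ℝ → ℝ) (y : ℝ) (hy : y = 1 ∨ y = -1) :
    |acoef f y| ≤ 4 * Fnorm f := by
  have h : |f 1 1 1| ≤ Fnorm f ∧ |f 1 (-1) 1| ≤ Fnorm f ∧ |f (-1) 1 1| ≤ Fnorm f ∧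
      |f (-1) (-1) 1| ≤ Fnorm f ∧ |f 1 1 (-1)| ≤ Fnorm f ∧ |f 1 (-1) (-1)| ≤ Fnorm f ∧
      |f (-1) 1 (-1)| ≤ Fnorm f ∧ |f (-1) (-1) (-1)| ≤ Fnorm f := by
    have h0 : Fnorm f ≤ Fnorm f := le_rfl
    conv at h0 => lhs; unfold Fnorm
    simp only [sup_le_iff] at h0
    tauto
  simp only [abs_le] at h
  unfold acoef
  rw [abs_le]
  rcases hy with rfl | rfl <;> constructor <;> linarith

/-- Lipschitzness of the gradient of the progress measure: if `g` is `L`-Lipschitz on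
`[−1,1]`, then for all `ν, ν' ∈ [−1,1]ⁿ`,
`‖∇P(ν) − ∇P(ν')‖₂ ≤ (‖f‖_∞·L/n)·‖ν − ν'‖₂`, where
`(∇P(ν))_i = −(1/(4n))·(a_{y_i}·g(ν_i) + b_{y_i})`. -/
theorem stmt16 {X : Type*} (n : ℕ) (hn : 1 ≤ n) (x : Fin n → X) (y : Fin n → ℝ)
    (hy : ∀ i, y i = 1 ∨ y i = -1) (f : ℝ → ℝ → ℝ → ℝ) (L : ℝ) (hL : 0 ≤ L)
    (g : ℝ → ℝ)
    (hg : ∀ s ∈ Set.Icc (-1:ℝ) 1, ∀ t ∈ Set.Icc (-1:ℝ) 1, |g s - g t| ≤ L * |s - t|)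
    (ν ν' : Fin n → ℝ)
    (hν : ∀ i, ν i ∈ Set.Icc (-1:ℝ) 1) (hν' : ∀ i, ν' i ∈ Set.Icc (-1:ℝ) 1) :
    Real.sqrt (∑ i,
        (-(1/(4*(n:ℝ))) * (acoef f (y i) * g (ν i) + bcoef f (y i))
          - (-(1/(4*(n:ℝ))) * (acoef f (y i) * g (ν' i) + bcoef f (y i))))^2)
      ≤ (Fnorm f * L / (n:ℝ)) * Real.sqrt (∑ i, (ν i - ν' i)^2) := by
  have hn' : (0:ℝ) < n := by exact_mod_cast hn
  have hF : 0 ≤ Fnorm f := by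
    have := acoef_abs_le f 1 (Or.inl rfl)
    have := abs_nonneg (acoef f 1)
    linarith
  have hC : 0 ≤ Fnorm f * L / (n:ℝ) := by positivity
  rw [← Real.sqrt_sq hC, ← Real.sqrt_mul (sq_nonneg _), Finset.mul_sum]
  apply Real.sqrt_le_sqrt
  apply Finset.sum_le_sum
  intro i _
  rw [← mul_pow]
  apply sq_le_sq.mpr
  have e : -(1/(4*(n:ℝ))) * (acoef f (y i) * g (ν i) + bcoef f (y i))
      - (-(1/(4*(n:ℝ))) * (acoef f (y i) * g (ν' i) + bcoef f (y i)))
      = -(1/(4*(n:ℝ)) * (acoef f (y i) * (g (ν i) - g (ν' i)))) := by ring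
  rw [e, abs_neg, abs_mul, abs_mul, abs_mul, abs_of_nonneg hC,
    abs_of_nonneg (by positivity : 0 ≤ 1/(4*(n:ℝ)))]
  calc 1/(4*(n:ℝ)) * (|acoef f (y i)| * |g (ν i) - g (ν' i)|)
      ≤ 1/(4*(n:ℝ)) * ((4 * Fnorm f) * (L * |ν i - ν' i|)) := by
        gcongr
        · exact acoef_abs_le f (y i) (hy i)
        · exact hg _ (hν i) _ (hν' i)
    _ = Fnorm f * L / (n:ℝ) * |ν i - ν' i| := by field_simp
end

section
/- Let S = ((x_1,y_1),…,(x_n,y_n)) be a dataset of size n ≥ 1 over X, f : {−1,1}³ → ℝ with coefficients a_y, b_y, Q_y, and g : [−1,1] → [−1,1] be g-feasible for f, i.e. t·(a_y·g(t) + b_y) + Q_y(g(t)) ≤ 0 for every t ∈ [−1,1] and y ∈ {−1,1}. Let C be a nonempty collection of functions X → {−1,1} and Ω := conv{(c(x_1),…,c(x_n)) : c ∈ C} ⊆ ℝⁿ. Then for every μ : X → [−1,1] and every c ∈ C, ℓ_S^f(c, g∘μ) ≤ sup_{ω ∈ Ω} ⟨∇P(μ_S), μ_S − ω⟩, where μ_S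 := (μ(x_1),…,μ(x_n)) and ∇P(μ_S) is the vector whose i-th entry is −(1/(4n))·(a_{y_i}·g(μ(x_i)) + b_{y_i}). -/
/-- `Q_y(t) := (1+t)·(f(1,1,y) + f(−1,1,y)) + (1−t)·(f(1,−1,y) + f(−1,−1,y))`. -/
def Qcoef (f : ℝ → ℝ → ℝ → ℝ) (y t : ℝ) : ℝ :=
  (1+t) * (f 1 1 y + f (-1) 1 y) + (1-t) * (f 1 (-1) y + f (-1) (-1) y)

/-- The duality gap bounds the loss: if `g` maps `[−1,1]` to `[−1,1]` and is
`g`-feasible for `f`, then for every `μ : X → [−1,1]` and `c ∈ C`,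
`ℓ_S^f(c, g∘μ) ≤ sup_{ω ∈ Ω} ⟨∇P(μ_S), μ_S − ω⟩` where
`Ω = conv{(c'(x_1),…,c'(x_n)) : c' ∈ C}`. -/
theorem stmt17 {X : Type*} (n : ℕ) (hn : 1 ≤ n) (x : Fin n → X) (y : Fin n → ℝ)
    (hy : ∀ i, y i = 1 ∨ y i = -1) (f : ℝ → ℝ → ℝ → ℝ) (g : ℝ → ℝ)
    (hg_range : ∀ t ∈ Set.Icc (-1:ℝ) 1, g t ∈ Set.Icc (-1:ℝ) 1)
    (hfeas : ∀ t ∈ Set.Icc (-1:ℝ) 1, ∀ y' : ℝ, (y' = 1 ∨ y' = -1) →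
      t * (acoef f y' * g t + bcoef f y') + Qcoef f y' (g t) ≤ 0)
    (C : Set (X → ℝ)) (hCne : C.Nonempty) (hC : ∀ c ∈ C, ∀ a, c a = 1 ∨ c a = -1)
    (μ : X → ℝ) (hμ : ∀ a, μ a ∈ Set.Icc (-1:ℝ) 1) (c : X → ℝ) (hc : c ∈ C) :
    (1/(4*(n:ℝ))) * ∑ i,
        (c (x i) * (acoef f (y i) * g (μ (x i)) + bcoef f (y i))
          + Qcoef f (y i) (g (μ (x i))))
      ≤ sSup {r : ℝ |
          ∃ ω ∈ convexHull ℝ {v : Fin n → ℝ | ∃ c' ∈ C, v = fun i => c' (x i)},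
            r = ∑ i, (-(1/(4*(n:ℝ))) * (acoef f (y i) * g (μ (x i)) + bcoef f (y i)))
                  * (μ (x i) - ω i)} := by
  have hsub : convexHull ℝ {v : Fin n → ℝ | ∃ c' ∈ C, v = fun i => c' (x i)}
      ⊆ Set.Icc (fun _ => (-1:ℝ)) (fun _ => 1) := by
    apply convexHull_min _ (convex_Icc _ _)
    rintro v ⟨c', hc', rfl⟩
    constructor <;> intro i <;> rcases hC c' hc' (x i) with h | h <;> simp [h]
  refine le_trans ?_ (le_csSup (a := ∑ i, (-(1/(4*(n:ℝ))) *
    (acoef f (y i) * g (μ (x i)) + bcoef f (y i))) * (μ (x i) - c (x i))) ?_ ?_)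
  · rw [Finset.mul_sum]
    apply Finset.sum_le_sum
    intro i _
    have h := hfeas _ (hμ (x i)) _ (hy i)
    have hk : (0:ℝ) ≤ 1/(4*(n:ℝ)) := by positivity
    have := mul_nonpos_of_nonneg_of_nonpos hk h
    linarith
  · refine ⟨∑ i, |(-(1/(4*(n:ℝ))) *
      (acoef f (y i) * g (μ (x i)) + bcoef f (y i)))| * 2, ?_⟩
    rintro r ⟨ω, hω, rfl⟩
    apply Finset.sum_le_sum
    intro i _
    have h1 := (hsub hω).1 i
    have h2 := (hsub hω).2 i
    have h3 := hμ (x i)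
    simp only [Set.mem_Icc] at h1 h2 h3
    refine (le_abs_self _).trans ?_
    rw [abs_mul]
    refine mul_le_mul_of_nonneg_left ?_ (abs_nonneg _)
    rw [abs_le]
    constructor <;> linarith [h3.1, h3.2]
  · exact ⟨fun i => c (x i), subset_convexHull ℝ _ ⟨c, hc, rfl⟩, rfl⟩
end

section
/- Let X be a measurable space, D a probability measure on X, c* : X → {−1,1}, and f : X → [−1,1] D-integrable. (i) If S° = ((x°_1,y°_1),…,(x°_n,y°_n)) is a dataset of size n ≥ 1 over X with y°_i = c*(x°_i) for every i, then η(c*, f, S°, D) = (1/2)·((1/n)·Σ_{i=1}^n f(x°_i) − ∫ f dD). (ii) If S = ((x_1,y_1),…,(x_n,y_n)) and S° = ((x°_1,y°_1),…,(x°_n,y°_n)) are any two datasets of size n ≥ 1 over X, then η(c*, f, S, D) − η(c*, f, S°, D) ≤ |{i : (x_i,y_i) ≠ (x°_i,y°_i)}| / n. -/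
open MeasureTheory
open scoped Classical

/-- (i) On a clean dataset `S°` labeled by `c*`,
`η(c*, f, S°, D) = (1/2)·((1/n)·Σ_i f(x°_i) − ∫ f dD)`.
(ii) For any two datasets `S, S°` of size `n`,
`η(c*, f, S, D) − η(c*, f, S°, D) ≤ |{i : (x_i,y_i) ≠ (x°_i,y°_i)}|/n`. -/
theorem stmt18 {X : Type*} [MeasurableSpace X] (D : Measure X) [IsProbabilityMeasure D]
    (cstar : X → ℝ) (hcs : ∀ a, cstar a = 1 ∨ cstar a = -1)
    (f : X → ℝ) (hf : ∀ a, f a ∈ Set.Icc (-1:ℝ) 1) (hint : Integrable f D) :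
    (∀ (n : ℕ), 1 ≤ n → ∀ (x0 : Fin n → X) (y0 : Fin n → ℝ),
      (∀ i, y0 i = cstar (x0 i)) →
      etaEst D n x0 y0 cstar f
        = (1/2) * ((1/(n:ℝ)) * ∑ i, f (x0 i) - ∫ a, f a ∂D)) ∧
    (∀ (n : ℕ), 1 ≤ n → ∀ (x : Fin n → X) (y : Fin n → ℝ), (∀ i, y i = 1 ∨ y i = -1) →
      ∀ (x0 : Fin n → X) (y0 : Fin n → ℝ), (∀ i, y0 i = 1 ∨ y0 i = -1) →
      etaEst D n x y cstar f - etaEst D n x0 y0 cstar f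
        ≤ ((Finset.univ.filter (fun i => (x i, y i) ≠ (x0 i, y0 i))).card : ℝ) / n) := by
  constructor
  · intro n hn x0 y0 hy
    have h : ∀ i, 1 + f (x0 i) + cstar (x0 i) * y0 i * (f (x0 i) - 1) = 2 * f (x0 i) := by
      intro i
      rw [hy i]
      rcases hcs (x0 i) with h | h <;> rw [h] <;> ring
    have hn' : (n : ℝ) ≠ 0 := by
      have : n ≠ 0 := by omega
      exact_mod_cast this
    unfold etaEst
    rw [Finset.sum_congr rfl (fun i _ => h i), ← Finset.mul_sum]
    field_simp
    ring
  · intro n hn x y hy x0 y0 hy0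
    have hn' : (0 : ℝ) < n := by exact_mod_cast hn
    have key : ∑ i, (1 + f (x i) + cstar (x i) * y i * (f (x i) - 1))
        - ∑ i, (1 + f (x0 i) + cstar (x0 i) * y0 i * (f (x0 i) - 1))
        ≤ 4 * ((Finset.univ.filter (fun i => (x i, y i) ≠ (x0 i, y0 i))).card : ℝ) := by
      rw [← Finset.sum_sub_distrib, Finset.card_filter, Nat.cast_sum, Finset.mul_sum]
      refine Finset.sum_le_sum fun i _ => ?_
      by_cases h : (x i, y i) = (x0 i, y0 i)
      · have h1 : x i = x0 i := congrArg Prod.fst h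
        have h2 : y i = y0 i := congrArg Prod.snd h
        simp [h1, h2]
      · rw [if_pos h]
        obtain ⟨a1, a2⟩ := hf (x i)
        obtain ⟨b1, b2⟩ := hf (x0 i)
        push_cast
        rcases hcs (x i) with h1 | h1 <;> rcases hcs (x0 i) with h2 | h2 <;>
          rcases hy i with h3 | h3 <;> rcases hy0 i with h4 | h4 <;>
          rw [h1, h2, h3, h4] <;> linarith
    unfold etaEst
    rw [le_div_iff₀ hn']
    have e : ∀ A B I : ℝ, (1 / (4 * (n : ℝ)) * A - 1 / 2 * I
        - (1 / (4 * (n : ℝ)) * B - 1 / 2 * I)) * n = (A - B) / 4 := by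
      intro A B I
      field_simp
      ring
    rw [e]
    linarith
end
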